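/- Let a_n denote the number of unlabelled word-representable graphs on n vertices (i.e. the number of isomorphism classes of word-representable simple graphs with n vertices). Then (log₂ a_n)/C(n,2) tends to 2/3 as n tends to infinity, where C(n,2) = n(n−1)/2. -/

import Mathlib

def Alternates {V : Type*} [DecidableEq V] (w : List V) (x y : V) : Prop :=
  (w.filter (fun z => z = x ∨ z = y)).Chain' (· ≠ ·)

def Represents {V : Type*} [DecidableEq V] (w : List V) (G : SimpleGraph V) : Prop :=
  (∀ v : V, v ∈ w) ∧ ∀ x y : V, x ≠ y → (Alternates w x y ↔ G.Adj x y)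

def WordRepresentable {V : Type*} [DecidableEq V] (G : SimpleGraph V) : Prop :=
  ∃ w : List V, Represents w G

/-- The number of word-representable graphs on `n` vertices, counted up to isomorphism. -/
noncomputable def numUnlabelled (n : ℕ) : ℕ :=
  Nat.card
    (Quot (fun G H : {G : SimpleGraph (Fin n) // WordRepresentable G} => Nonempty (G.1 ≃g H.1)))


section Count

lemma count_fun {ι X : Type} [Fintype ι] [DecidableEq ι] (S : Finset X) (p : X → Prop)
    [DecidablePred p] (hS : S.Nonempty) (B : ℕ) :
    ((Fintype.piFinset fun _ : ι => S).filter
      (fun g => (Finset.univ.filter (fun v => ¬ p (g v))).card ≤ B)).card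
      ≤ S.card ^ B * ((S.filter p).card + 1) ^ (Fintype.card ι) := by
  obtain ⟨l, hldef⟩ : ∃ l : ℝ, l = (S.card : ℝ) := ⟨_, rfl⟩
  have hl : (1 : ℝ) ≤ l := by rw [hldef]; exact_mod_cast hS.card_pos
  have hl0 : (0 : ℝ) < l := by linarith
  have key : (((Fintype.piFinset fun _ : ι => S).filter
      (fun g => (Finset.univ.filter (fun v => ¬ p (g v))).card ≤ B)).card : ℝ)
      ≤ l ^ B * (((S.filter p).card : ℝ) + 1) ^ (Fintype.card ι) := by
    calc (((Fintype.piFinset fun _ : ι => S).filter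
      (fun g => (Finset.univ.filter (fun v => ¬ p (g v))).card ≤ B)).card : ℝ)
        = ∑ g ∈ ((Fintype.piFinset fun _ : ι => S).filter
      (fun g => (Finset.univ.filter (fun v => ¬ p (g v))).card ≤ B)), (1 : ℝ) := by simp
      _ ≤ ∑ g ∈ ((Fintype.piFinset fun _ : ι => S).filter
      (fun g => (Finset.univ.filter (fun v => ¬ p (g v))).card ≤ B)),
          l ^ B * ∏ v, (if p (g v) then 1 else l⁻¹) := by
          apply Finset.sum_le_sum
          intro g hg
          rw [Finset.mem_filter] at hg
          rw [Finset.prod_ite]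
          simp only [Finset.prod_const_one, one_mul, Finset.prod_const, inv_pow]
          rw [← div_eq_mul_inv, one_le_div (by positivity)]
          exact pow_le_pow_right₀ hl hg.2
      _ ≤ ∑ g ∈ (Fintype.piFinset fun _ : ι => S), l ^ B * ∏ v, (if p (g v) then 1 else l⁻¹) := by
          apply Finset.sum_le_sum_of_subset_of_nonneg (Finset.filter_subset _ _)
          intro g _ _
          apply mul_nonneg (by positivity)
          apply Finset.prod_nonneg
          intro i _
          split_ifs <;> positivity
      _ = l ^ B * ∏ _v : ι, ∑ x ∈ S, (if p x then 1 else l⁻¹) := by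
          rw [← Finset.mul_sum, Finset.prod_univ_sum]
      _ ≤ l ^ B * (((S.filter p).card : ℝ) + 1) ^ (Fintype.card ι) := by
          gcongr
          rw [Finset.prod_const, Finset.card_univ]
          apply pow_le_pow_left₀
          · apply Finset.sum_nonneg
            intro i _
            split_ifs <;> positivity
          · rw [Finset.sum_ite]
            simp only [Finset.sum_const, nsmul_eq_mul, mul_one]
            gcongr
            rw [← div_eq_mul_inv, div_le_one hl0, hldef]
            exact_mod_cast Finset.card_filter_le _ _
  rw [hldef] at key
  exact_mod_cast key

lemma card_small {V : Type} [DecidableEq V] (A : Finset V) (t : ℕ) (hA : 1 ≤ A.card) :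
    (A.powerset.filter (fun X => X.card < t)).card ≤ t * A.card ^ t := by
  have : A.powerset.filter (fun X => X.card < t) ⊆
      (Finset.range t).biUnion (fun j => A.powersetCard j) := by
    intro X hX
    simp only [Finset.mem_filter, Finset.mem_powerset] at hX
    simp only [Finset.mem_biUnion, Finset.mem_range, Finset.mem_powersetCard]
    exact ⟨X.card, hX.2, hX.1, rfl⟩
  refine (Finset.card_le_card this).trans (Finset.card_biUnion_le.trans ?_)
  calc ∑ u ∈ Finset.range t, (A.powersetCard u).card ≤ ∑ u ∈ Finset.range t, A.card ^ t := by
        apply Finset.sum_le_sum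
        intro j hj
        rw [Finset.card_powersetCard]
        exact (Nat.choose_le_pow _ _).trans
          (Nat.pow_le_pow_right hA (Finset.mem_range.1 hj).le)
    _ = _ := by simp

lemma card_good {V : Type} [DecidableEq V] (r t T : ℕ) (hT : 1 ≤ T) (W : Finset V)
    (A : Fin r → Finset V) (hAW : ∀ i, A i ⊆ W) (hAT : ∀ i, (A i).card = T) :
    (W.powerset.filter (fun X => ∃ i, (X ∩ A i).card < t)).card
      ≤ r * (t * T ^ t * 2 ^ (W.card - T)) := by
  have : W.powerset.filter (fun X => ∃ i, (X ∩ A i).card < t) ⊆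
      (Finset.univ : Finset (Fin r)).biUnion
        (fun i => W.powerset.filter (fun X => (X ∩ A i).card < t)) := by
    intro X hX
    simp only [Finset.mem_filter, Finset.mem_powerset] at hX
    simp only [Finset.mem_biUnion, Finset.mem_filter, Finset.mem_powerset, Finset.mem_univ,
      true_and]
    obtain ⟨h1, i, h2⟩ := hX
    exact ⟨i, h1, h2⟩
  refine (Finset.card_le_card this).trans (Finset.card_biUnion_le.trans ?_)
  calc _ ≤ ∑ _i : Fin r, (t * T ^ t * 2 ^ (W.card - T)) := by
        apply Finset.sum_le_sum
        intro i _
        have hc : ((A i).powerset.filter (fun X => X.card < t) ×ˢ (W \ A i).powerset).card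
            ≤ t * T ^ t * 2 ^ (W.card - T) := by
          rw [Finset.card_product, Finset.card_powerset, Finset.card_sdiff_of_subset (hAW i), hAT i]
          gcongr
          have := card_small (A i) t (by rw [hAT i]; exact hT)
          rwa [hAT i] at this
        refine le_trans ?_ hc
        apply Finset.card_le_card_of_injOn (fun X => (X ∩ A i, X \ A i))
        · intro X hX
          simp only [Finset.coe_filter, Finset.mem_powerset, Set.mem_ofPred_eq] at hX
          simp only [Finset.coe_product, Set.mem_prod, Finset.mem_coe, Finset.mem_filter,
            Finset.mem_powerset]
          exact ⟨⟨Finset.inter_subset_right, hX.2⟩, Finset.sdiff_subset_sdiff hX.1 le_rfl⟩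
        · intro X _ Y _ h
          simp only [Prod.mk.injEq] at h
          rw [← Finset.sdiff_union_inter X (A i), ← Finset.sdiff_union_inter Y (A i), h.1, h.2]
    _ = _ := by simp

def Blow {V : Type} (G : SimpleGraph V) (U : Finset V) (r t : ℕ) : Prop :=
  ∃ A : Fin r → Finset V, (∀ i, A i ⊆ U) ∧ (∀ i, (A i).card = t) ∧
    ∀ i j, i ≠ j → ∀ x ∈ A i, ∀ y ∈ A j, G.Adj x y

open Classical in
noncomputable def Fam {V : Type} [Fintype V] (U : Finset V) (r t : ℕ) :
    Finset (SimpleGraph V) :=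
  Finset.univ.filter (fun G => (∀ x y, G.Adj x y → x ∈ U ∧ y ∈ U) ∧ ¬ Blow G U r t)

def restr {V : Type} (G : SimpleGraph V) (U : Finset V) : SimpleGraph V where
  Adj x y := G.Adj x y ∧ x ∈ U ∧ y ∈ U
  symm := ⟨fun _ _ h => ⟨h.1.symm, h.2.2, h.2.1⟩⟩
  loopless := ⟨fun _ h => G.loopless.irrefl _ h.1⟩

open Classical in
lemma card_fixed {V : Type} [Fintype V] (U : Finset V) (r t T : ℕ) (hT : 1 ≤ T)
    (A : Fin r → Finset V) (hAU : ∀ i, A i ⊆ U) (hAT : ∀ i, (A i).card = T)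
    (hdisj : ∀ i j, i ≠ j → Disjoint (A i) (A j)) :
    r * T ≤ U.card ∧ ∃ U' : Finset V, U'.card = U.card - r * T ∧
    ((Fam U (r+1) t).filter (fun G => ∀ i j, i ≠ j → ∀ x ∈ A i, ∀ y ∈ A j, G.Adj x y)).card
    ≤ (Fam U' (r+1) t).card * 2 ^ ((r*T)*(r*T)) * ((2 ^ (r*T)) ^ (t * 2 ^ (r*T)) *
      (r * (t * T ^ t * 2 ^ (r * T - T)) + 1) ^ (U.card - r * T)) := by
  obtain ⟨W, hW⟩ : ∃ W : Finset V, W = Finset.univ.biUnion A := ⟨_, rfl⟩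
  have hWc : W.card = r * T := by
    rw [hW, Finset.card_biUnion (fun i _ j _ h => hdisj i j h)]
    simp [hAT]
  have hAW : ∀ i, A i ⊆ W := fun i => by
    rw [hW]; exact Finset.subset_biUnion_of_mem A (Finset.mem_univ i)
  have hWU : W ⊆ U := by
    rw [hW]; exact Finset.biUnion_subset.2 (fun i _ => hAU i)
  refine ⟨by rw [← hWc]; exact Finset.card_le_card hWU, U \ W, ?_, ?_⟩
  · rw [Finset.card_sdiff_of_subset hWU, hWc]
  have hU'c : Fintype.card (↥(U \ W)) = U.card - r * T := by
    rw [Fintype.card_coe, Finset.card_sdiff_of_subset hWU, hWc]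
  have h1 := count_fun (ι := ↥(U \ W)) W.powerset (fun X => ∃ i, (X ∩ A i).card < t)
    ⟨∅, by simp⟩ (t * 2 ^ (r*T))
  rw [Finset.card_powerset, hWc, hU'c] at h1
  have h2 := card_good r t T hT W A hAW hAT
  rw [hWc] at h2
  obtain ⟨Fn, hFn⟩ : ∃ Fn : Finset (↥(U \ W) → Finset V), Fn =
    ((Fintype.piFinset fun _ : ↥(U \ W) => W.powerset).filter
      (fun g => (Finset.univ.filter (fun v => ¬ ∃ i, (g v ∩ A i).card < t)).card
        ≤ t * 2 ^ (r*T))) := ⟨_, rfl⟩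
  rw [← hFn] at h1
  have h3 : Fn.card ≤ (2 ^ (r*T)) ^ (t * 2 ^ (r*T)) *
      (r * (t * T ^ t * 2 ^ (r * T - T)) + 1) ^ (U.card - r * T) := by
    refine h1.trans ?_
    gcongr
  have h4 : ((W ×ˢ W).powerset).card = 2 ^ ((r*T)*(r*T)) := by
    rw [Finset.card_powerset, Finset.card_product, hWc]
  calc _ ≤ ((Fam (U \ W) (r+1) t ×ˢ (W ×ˢ W).powerset) ×ˢ Fn).card := ?_
    _ = (Fam (U \ W) (r+1) t).card * 2 ^ ((r*T)*(r*T)) * Fn.card := by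
      rw [Finset.card_product, Finset.card_product, h4]
    _ ≤ _ := by gcongr
  apply Finset.card_le_card_of_injOn (fun G => ((restr G (U \ W),
    (W ×ˢ W).filter (fun q => G.Adj q.1 q.2)), fun v => W.filter (fun y => G.Adj v.1 y)))
  · intro G hG
    simp only [Finset.coe_filter, Set.mem_ofPred_eq, Fam, Finset.mem_filter, Finset.mem_univ,
      true_and] at hG
    obtain ⟨⟨hGU, hGB⟩, hGA⟩ := hG
    simp only [Finset.coe_product, Set.mem_prod, Finset.mem_coe, Fam, Finset.mem_filter,
      Finset.mem_univ, true_and]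
    refine ⟨⟨⟨fun x y h => ⟨h.2.1, h.2.2⟩, ?_⟩, ?_⟩, ?_⟩
    · rintro ⟨D, hD1, hD2, hD3⟩
      exact hGB ⟨D, fun i => (hD1 i).trans Finset.sdiff_subset, hD2,
        fun i j hij x hx y hy => (hD3 i j hij x hx y hy).1⟩
    · rw [Finset.mem_powerset]; exact Finset.filter_subset _ _
    · rw [hFn, Finset.mem_filter]
      constructor
      · rw [Fintype.mem_piFinset]
        intro v
        rw [Finset.mem_powerset]; exact Finset.filter_subset _ _
      · rw [← hWc, ← Finset.card_powerset]
        apply Finset.card_le_mul_card_image_of_maps_to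
          (f := fun v : ↥(U \ W) => W.filter (fun y => G.Adj v.1 y))
        · intro v _
          simp only [Finset.mem_powerset]
          exact Finset.filter_subset _ _
        · intro X hX
          by_contra hcon
          push Not at hcon
          obtain ⟨D, hD1, hD2⟩ := Finset.exists_subset_card_eq hcon.le
          have htpos : 0 ≤ t := Nat.zero_le t
          have hXb : ∀ i, t ≤ (X ∩ A i).card := by
            obtain ⟨v, hv⟩ := Finset.card_pos.1 (lt_of_le_of_lt htpos hcon)
            simp only [Finset.mem_filter, Finset.mem_univ, true_and] at hv
            intro i
            rw [← hv.2]; exact hv.1 i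
          choose A' hA'1 hA'2 using fun i => Finset.exists_subset_card_eq (hXb i)
          have hadj : ∀ i, ∀ x ∈ D.map (Function.Embedding.subtype _), ∀ y ∈ A' i, G.Adj x y := by
            intro i x hx y hy
            simp only [Finset.mem_map, Function.Embedding.coe_subtype] at hx
            obtain ⟨v, hv, rfl⟩ := hx
            have hv' := hD1 hv
            have hy' := Finset.mem_inter.1 (hA'1 i hy)
            simp only [Finset.mem_filter] at hv'
            rw [← hv'.2] at hy'
            exact (Finset.mem_filter.1 hy'.1).2
          apply hGB
          refine ⟨Fin.cons (D.map (Function.Embedding.subtype _)) A', ?_, ?_, ?_⟩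
          · intro i
            refine Fin.cases ?_ (fun i => ?_) i
            · intro x hx
              simp only [Fin.cons_zero, Finset.mem_map, Function.Embedding.coe_subtype] at hx
              obtain ⟨v, hv, rfl⟩ := hx
              exact (Finset.mem_sdiff.1 v.2).1
            · simp only [Fin.cons_succ]
              exact (hA'1 i).trans (Finset.inter_subset_right.trans (hAU i))
          · intro i
            refine Fin.cases ?_ (fun i => ?_) i
            · simp [hD2]
            · simp [hA'2]
          · intro i j
            refine Fin.cases ?_ (fun i => ?_) i
            · refine Fin.cases ?_ (fun j => ?_) j
              · intro h; exact absurd rfl h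
              · intro _ x hx y hy
                simp only [Fin.cons_succ, Fin.cons_zero] at hx hy
                exact hadj j x hx y hy
            · refine Fin.cases ?_ (fun j => ?_) j
              · intro _ x hx y hy
                simp only [Fin.cons_succ, Fin.cons_zero] at hx hy
                exact (hadj i y hy x hx).symm
              · intro hij x hx y hy
                simp only [Fin.cons_succ] at hx hy
                exact hGA i j (fun h => hij (by rw [h])) x (Finset.mem_inter.1 (hA'1 i hx)).2 y
                  (Finset.mem_inter.1 (hA'1 j hy)).2
  · intro G hG H hH h
    simp only [Finset.coe_filter, Set.mem_ofPred_eq, Fam, Finset.mem_filter, Finset.mem_univ,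
      true_and] at hG hH
    simp only [Prod.mk.injEq] at h
    obtain ⟨⟨e1, e2⟩, e3⟩ := h
    have c1 : ∀ x y, x ∈ U \ W → y ∈ U \ W → (G.Adj x y ↔ H.Adj x y) := by
      intro x y hx hy
      have := congrArg (fun K => K.Adj x y) e1
      simpa [restr, Finset.mem_sdiff.1 hx, Finset.mem_sdiff.1 hy] using this
    have c2 : ∀ x y, x ∈ W → y ∈ W → (G.Adj x y ↔ H.Adj x y) := by
      intro x y hx hy
      have := Finset.ext_iff.1 e2 (x, y)
      simpa [hx, hy] using this
    have c3 : ∀ x y, x ∈ U \ W → y ∈ W → (G.Adj x y ↔ H.Adj x y) := by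
      intro x y hx hy
      have := Finset.ext_iff.1 (congrFun e3 ⟨x, hx⟩) y
      simpa [hy] using this
    have c : ∀ x y, x ∈ U → y ∈ U → (G.Adj x y ↔ H.Adj x y) := by
      intro x y hx hy
      by_cases hxW : x ∈ W
      · by_cases hyW : y ∈ W
        · exact c2 x y hxW hyW
        · rw [G.adj_comm, H.adj_comm]
          exact c3 y x (Finset.mem_sdiff.2 ⟨hy, hyW⟩) hxW
      · by_cases hyW : y ∈ W
        · exact c3 x y (Finset.mem_sdiff.2 ⟨hx, hxW⟩) hyW
        · exact c1 x y (Finset.mem_sdiff.2 ⟨hx, hxW⟩) (Finset.mem_sdiff.2 ⟨hy, hyW⟩)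
    ext x y
    constructor
    · intro hxy
      have := hG.1.1 x y hxy
      exact (c x y this.1 this.2).1 hxy
    · intro hxy
      have := hH.1.1 x y hxy
      exact (c x y this.1 this.2).2 hxy

/-- The basic recursion, with `f` any bound for the graphs on fewer vertices. -/
lemma fam_rec {V : Type} [Fintype V] (U : Finset V) (r t T : ℕ) (hT : 1 ≤ T) (f : ℝ) (hf0 : 0 ≤ f)
    (hf : r * T ≤ U.card → ∀ U' : Finset V, U'.card = U.card - r * T →
      ((Fam U' (r+1) t).card : ℝ) ≤ f) :
    ((Fam U (r+1) t).card : ℝ) ≤ (Fam U r T).card + (2 ^ U.card) ^ r *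
      (f * 2 ^ ((r*T)*(r*T)) * ((2 ^ (r*T)) ^ (t * 2 ^ (r*T)) *
      (r * (t * T ^ t * 2 ^ (r * T - T)) + 1) ^ (U.card - r * T))) := by
  classical
  obtain ⟨Q, hQ⟩ : ∃ Q : Finset (Fin r → Finset V),
    Q = (Fintype.piFinset fun _ : Fin r => U.powerset).filter (fun A => ∀ i, (A i).card = T) :=
    ⟨_, rfl⟩
  have hQc : Q.card ≤ (2 ^ U.card) ^ r := by
    rw [hQ]
    refine (Finset.card_filter_le _ _).trans ?_
    rw [Fintype.card_piFinset]; simp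
  have hsub : Fam U (r+1) t ⊆ Fam U r T ∪ Q.biUnion (fun A =>
      (Fam U (r+1) t).filter (fun G => ∀ i j, i ≠ j → ∀ x ∈ A i, ∀ y ∈ A j, G.Adj x y)) := by
    intro G hG
    by_cases hB : Blow G U r T
    · obtain ⟨A, h1, h2, h3⟩ := hB
      apply Finset.mem_union_right
      rw [Finset.mem_biUnion]
      refine ⟨A, ?_, Finset.mem_filter.2 ⟨hG, h3⟩⟩
      rw [hQ, Finset.mem_filter, Fintype.mem_piFinset]
      exact ⟨fun i => Finset.mem_powerset.2 (h1 i), h2⟩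
    · apply Finset.mem_union_left
      simp only [Fam, Finset.mem_filter, Finset.mem_univ, true_and] at hG ⊢
      exact ⟨hG.1, hB⟩
  have hb : ∀ A ∈ Q, (((Fam U (r+1) t).filter
      (fun G => ∀ i j, i ≠ j → ∀ x ∈ A i, ∀ y ∈ A j, G.Adj x y)).card : ℝ) ≤
      (f * 2 ^ ((r*T)*(r*T)) * ((2 ^ (r*T)) ^ (t * 2 ^ (r*T)) *
      (r * (t * T ^ t * 2 ^ (r * T - T)) + 1) ^ (U.card - r * T))) := by
    intro A hA
    rw [hQ, Finset.mem_filter, Fintype.mem_piFinset] at hA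
    obtain ⟨hA1, hA2⟩ := hA
    rcases Finset.eq_empty_or_nonempty ((Fam U (r+1) t).filter
      (fun G => ∀ i j, i ≠ j → ∀ x ∈ A i, ∀ y ∈ A j, G.Adj x y)) with he | ⟨G, hG⟩
    · rw [he]; simp only [Finset.card_empty, Nat.cast_zero]; positivity
    · have hG3 := (Finset.mem_filter.1 hG).2
      obtain ⟨hc, U', hU', hle⟩ := card_fixed U r t T hT A
        (fun i => Finset.mem_powerset.1 (hA1 i)) hA2 (by
          intro i j hij
          rw [Finset.disjoint_left]
          intro x hx hx'
          exact G.loopless.irrefl _ (hG3 i j hij x hx x hx'))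
      have hle' : (((Fam U (r+1) t).filter
        (fun G => ∀ i j, i ≠ j → ∀ x ∈ A i, ∀ y ∈ A j, G.Adj x y)).card : ℝ) ≤ 
        ((Fam U' (r+1) t).card * 2 ^ ((r*T)*(r*T)) * ((2 ^ (r*T)) ^ (t * 2 ^ (r*T)) *
        (r * (t * T ^ t * 2 ^ (r * T - T)) + 1) ^ (U.card - r * T))) := by exact_mod_cast hle
      refine hle'.trans ?_
      gcongr
      exact hf hc U' hU'
  have h1 : ((Fam U (r+1) t).card : ℝ) ≤ (Fam U r T).card + ∑ A ∈ Q, (((Fam U (r+1) t).filter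
      (fun G => ∀ i j, i ≠ j → ∀ x ∈ A i, ∀ y ∈ A j, G.Adj x y)).card : ℝ) := by
    have := (Finset.card_le_card hsub).trans ((Finset.card_union_le _ _).trans
      (Nat.add_le_add_left Finset.card_biUnion_le _))
    exact_mod_cast this
  refine h1.trans ?_
  gcongr
  refine (Finset.sum_le_sum hb).trans ?_
  rw [Finset.sum_const, nsmul_eq_mul]
  gcongr
  exact_mod_cast hQc

lemma fam_trivial {V : Type} [Fintype V] (U : Finset V) (r t : ℕ) :
    (Fam U r t).card ≤ 2 ^ (U.card * U.card) := by
  classical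
  rw [← Finset.card_product, ← Finset.card_powerset]
  apply Finset.card_le_card_of_injOn (fun G => (U ×ˢ U).filter (fun q => G.Adj q.1 q.2))
  · intro G _
    simp only [Finset.mem_coe, Finset.mem_powerset]
    exact Finset.filter_subset _ _
  · intro G hG H hH h
    simp only [Finset.mem_coe, Fam, Finset.mem_filter, Finset.mem_univ, true_and] at hG hH
    have c2 : ∀ x y, x ∈ U → y ∈ U → (G.Adj x y ↔ H.Adj x y) := by
      intro x y hx hy
      have := Finset.ext_iff.1 h (x, y)
      simpa [hx, hy] using this
    ext x y
    constructor
    · intro hxy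
      have := hG.1 x y hxy
      exact (c2 x y this.1 this.2).1 hxy
    · intro hxy
      have := hH.1 x y hxy
      exact (c2 x y this.1 this.2).2 hxy

lemma exists_T (s t : ℕ) (hs : 1 ≤ s) (ε : ℝ) (hε : 0 < ε) :
    ∃ T : ℕ, 1 ≤ T ∧ (2:ℝ) ^ s * (s * t * T ^ t + 1) ≤ 2 ^ (ε * s * T) := by
  have hs' : (1:ℝ) ≤ s := by exact_mod_cast hs
  have hb : (1:ℝ) < 2 ^ (ε * s) := Real.one_lt_rpow (by norm_num) (by positivity)
  have h := (isLittleO_pow_const_const_pow_of_one_lt (R := ℝ) t hb)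
  have h2 := h.def (c := ((2:ℝ) ^ s * (s * t + 1))⁻¹) (by positivity)
  obtain ⟨T, hT, hT1⟩ := (h2.and (Filter.eventually_ge_atTop 1)).exists
  refine ⟨T, hT1, ?_⟩
  rw [Real.rpow_mul (by norm_num), Real.rpow_natCast]
  rw [Real.norm_of_nonneg (by positivity), Real.norm_of_nonneg (by positivity),
    inv_mul_eq_div, le_div_iff₀ (by positivity)] at hT
  refine le_trans ?_ hT
  have : (1:ℝ) ≤ (T:ℝ) ^ t := one_le_pow₀ (by exact_mod_cast hT1)
  have h3 : (s:ℝ) * t * T ^ t + 1 ≤ (T:ℝ)^t * (s * t + 1) := by nlinarith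
  calc (2:ℝ) ^ s * (s * t * T ^ t + 1) ≤ 2 ^ s * ((T:ℝ)^t * (s * t + 1)) := by gcongr
    _ = _ := by ring

lemma fam_bound (r : ℕ) : ∀ (t : ℕ) (ε : ℝ), 0 < ε → ∃ C : ℝ, ∀ (V : Type) [Fintype V]
    (U : Finset V), ((Fam U (r+1) t).card : ℝ) ≤
      2 ^ ((((r:ℝ) - 1) / (2 * r) + ε) * (U.card : ℝ) ^ 2 + C) := by
  induction r with
  | zero =>
    intro t ε hε
    refine ⟨t * t, fun V _ U => ?_⟩
    by_cases h : t ≤ U.card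
    · obtain ⟨D, hD1, hD2⟩ := Finset.exists_subset_card_eq h
      have : Fam U (0+1) t = ∅ := by
        classical
        rw [Finset.eq_empty_iff_forall_notMem]
        intro G hG
        simp only [Fam, Finset.mem_filter, Finset.mem_univ, true_and] at hG
        exact hG.2 ⟨fun _ => D, fun _ => hD1, fun _ => hD2,
          fun i j hij => absurd (Fin.ext (by omega)) hij⟩
      rw [this]
      simp only [Finset.card_empty, Nat.cast_zero]
      positivity
    · have h1 : ((Fam U (0+1) t).card : ℝ) ≤ 2 ^ (U.card * U.card) := by
        exact_mod_cast fam_trivial U (0+1) t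
      refine h1.trans ?_
      rw [← Real.rpow_natCast]
      apply Real.rpow_le_rpow_of_exponent_le (by norm_num)
      have h2 : (U.card : ℝ) ≤ t := by exact_mod_cast (not_le.1 h).le
      have h3 : (U.card : ℝ) * U.card ≤ t * t := by gcongr
      push_cast
      simp only [mul_zero, div_zero, zero_add]
      have : 0 ≤ ε * (U.card:ℝ) ^ 2 := by positivity
      linarith
  | succ r ih =>
    intro t ε hε
    obtain ⟨T, hT1, hT⟩ := exists_T (r+1) t (by omega) ε hε
    obtain ⟨C0, hC0⟩ := ih T ε hε
    obtain ⟨c, hc⟩ : ∃ c : ℝ, c = (((r+1:ℕ):ℝ) - 1) / (2 * ((r+1:ℕ):ℝ)) := ⟨_, rfl⟩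
    rw [← hc]
    have hcs : 2 * c * (r + 1) = r := by
      rw [hc]; push_cast; field_simp; ring
    have hc0 : 0 ≤ c := by rw [hc]; push_cast; simp only [add_sub_cancel_right]; positivity
    have hcr : ((r:ℝ) - 1) / (2 * r) ≤ c := by
      rcases Nat.eq_zero_or_pos r with h0 | h0
      · subst h0; simpa using hc0
      · have : (0:ℝ) < r := by exact_mod_cast h0
        rw [hc, div_le_div_iff₀ (by positivity) (by positivity)]
        push_cast
        nlinarith
    have hTR : (1:ℝ) ≤ T := by exact_mod_cast hT1
    obtain ⟨k1, hk1⟩ : ∃ k1 : ℕ, k1 = ((r+1)*T)*((r+1)*T) + ((r+1)*T) * (t * 2 ^ ((r+1)*T)) :=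
      ⟨_, rfl⟩
    obtain ⟨N0, hN0⟩ := exists_nat_ge (k1 + (c+ε) * ((r+1) * T)^2 + 1 : ℝ)
    obtain ⟨N1, hN1⟩ := exists_nat_ge ((N0:ℝ) / (ε * (r+1) * T))
    obtain ⟨K, hK⟩ : ∃ K : ℝ, K = |C0| + 1 + N1 * N1 := ⟨_, rfl⟩
    refine ⟨K, fun V _ => ?_⟩
    have main : ∀ (n : ℕ) (U : Finset V), U.card = n → ((Fam U (r+1+1) t).card : ℝ) ≤
        2 ^ ((c + ε) * (n : ℝ) ^ 2 + K) := by
      intro n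
      induction n using Nat.strong_induction_on with
      | _ n IH =>
      intro U hU
      by_cases hn : n ≤ N1
      · have h1 : ((Fam U (r+1+1) t).card : ℝ) ≤ 2 ^ (U.card * U.card) := by
          exact_mod_cast fam_trivial U _ t
        refine h1.trans ?_
        rw [← Real.rpow_natCast, hU]
        apply Real.rpow_le_rpow_of_exponent_le (by norm_num)
        have h2 : (n : ℝ) ≤ N1 := by exact_mod_cast hn
        have h3 : (n : ℝ) * n ≤ N1 * N1 := by gcongr
        push_cast
        have : 0 ≤ (c+ε) * (n:ℝ) ^ 2 := by positivity
        have := abs_nonneg C0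
        linarith
      · have hnN : (N1:ℝ) ≤ n := by exact_mod_cast (not_le.1 hn).le
        have hnε : (N0:ℝ) ≤ ε * (r+1) * T * n := by
          rw [div_le_iff₀ (by positivity)] at hN1
          refine hN1.trans ?_
          rw [mul_comm]
          gcongr
        obtain ⟨m, hm⟩ : ∃ m : ℕ, m = (r+1) * T := ⟨_, rfl⟩
        have hmpos : 0 < m := by rw [hm]; positivity
        have h1 := fam_rec U (r+1) t T hT1
          (2 ^ ((c + ε) * ((n:ℝ) - ((r+1) * T)) ^ 2 + K)) (by positivity) (by
            intro hle U' hU'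
            have := IH (n - m) (by omega) U' (by rw [hU', hU, hm])
            rw [Nat.cast_sub (by rw [hm, ← hU]; exact hle), hm] at this
            push_cast at this
            exact this)
        have h2 := hC0 V U
        rw [hU] at h1 h2
        have h3 : ((Fam U (r+1) T).card : ℝ) ≤ 2 ^ ((c + ε) * (n : ℝ) ^ 2 + K - 1) := by
          refine h2.trans ?_
          apply Real.rpow_le_rpow_of_exponent_le (by norm_num)
          have e1 : (((r:ℝ) - 1) / (2 * r) + ε) * (n:ℝ)^2 ≤ (c + ε) * (n : ℝ) ^ 2 := by gcongr
          have := le_abs_self C0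
          have : (0:ℝ) ≤ N1 * N1 := by positivity
          linarith
        have h4 : ((2:ℝ) ^ n) ^ (r+1) * (((r+1:ℕ):ℝ) * (t * T ^ t * 2 ^ ((r+1) * T - T)) + 1)
            ^ (n - (r+1) * T) ≤ 2 ^ ((r * T + ε * (r+1) * T) * n) := by
          have e0 : (r+1) * T - T = r * T := by rw [Nat.add_mul, one_mul, Nat.add_sub_cancel]
          rw [e0]
          calc ((2:ℝ) ^ n) ^ (r+1) * (((r+1:ℕ):ℝ) * (t * T ^ t * 2 ^ (r * T)) + 1)
                ^ (n - (r+1) * T)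
              ≤ ((2:ℝ) ^ n) ^ (r+1) * (((r+1:ℕ):ℝ) * (t * T ^ t * 2 ^ (r * T)) + 1) ^ n := by
                gcongr
                · have : (0:ℝ) ≤ ((r+1:ℕ):ℝ) * (t * T ^ t * 2 ^ (r * T)) := by positivity
                  linarith
                · omega
            _ ≤ ((2:ℝ) ^ n) ^ (r+1) * (2 ^ (r*T) * (((r+1:ℕ):ℝ) * t * T ^ t + 1)) ^ n := by
                gcongr
                have : (1:ℝ) ≤ 2 ^ (r*T) := one_le_pow₀ (by norm_num)
                nlinarith
            _ = (2 ^ (r*T) * (2 ^ (r+1) * (((r+1:ℕ):ℝ) * t * T ^ t + 1))) ^ n := by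
                rw [← pow_mul, mul_comm n, pow_mul, ← mul_pow]
                ring
            _ ≤ (2 ^ (r*T) * 2 ^ (ε * ((r+1:ℕ):ℝ) * T)) ^ n := by gcongr
            _ = 2 ^ ((r * T + ε * (r+1) * T) * n) := by
                rw [← Real.rpow_natCast 2 (r*T), ← Real.rpow_add (by norm_num),
                  ← Real.rpow_natCast, ← Real.rpow_mul (by norm_num)]
                push_cast; rfl
        have h5 : (2:ℝ) ^ (((r+1)*T)*((r+1)*T)) * (2 ^ ((r+1)*T)) ^ (t * 2 ^ ((r+1)*T))
            = 2 ^ (k1:ℝ) := by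
          rw [Real.rpow_natCast, hk1, ← pow_mul, ← pow_add]
        calc ((Fam U (r+1+1) t).card : ℝ) ≤ _ := h1
          _ = ((Fam U (r+1) T).card : ℝ) + (((2:ℝ) ^ n) ^ (r+1) * (((r+1:ℕ):ℝ) *
              (t * T ^ t * 2 ^ ((r+1) * T - T)) + 1) ^ (n - (r+1) * T)) *
              ((2:ℝ) ^ (((r+1)*T)*((r+1)*T)) * (2 ^ ((r+1)*T)) ^ (t * 2 ^ ((r+1)*T))) *
              2 ^ ((c + ε) * ((n:ℝ) - ((r+1) * T)) ^ 2 + K) := by ring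
          _ ≤ 2 ^ ((c + ε) * (n : ℝ) ^ 2 + K - 1) + 2 ^ ((r * T + ε * (r+1) * T) * n) *
              2 ^ (k1:ℝ) * 2 ^ ((c + ε) * ((n:ℝ) - ((r+1) * T)) ^ 2 + K) := by
              rw [h5]; gcongr
          _ ≤ 2 ^ ((c + ε) * (n : ℝ) ^ 2 + K - 1) + 2 ^ ((c + ε) * (n : ℝ) ^ 2 + K - 1) := by
              rw [← Real.rpow_add (by norm_num), ← Real.rpow_add (by norm_num)]
              gcongr
              · norm_num
              · have e1 : (c + ε) * ((n:ℝ) - ((r+1) * T)) ^ 2 = (c+ε) * n^2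
                    - (2 * c * (r+1)) * T * n - 2 * (ε * (r+1) * T * n)
                    + (c+ε) * ((r+1) * T)^2 := by ring
                rw [e1, hcs]
                linarith
          _ = 2 ^ ((c + ε) * (n : ℝ) ^ 2 + K) := by
              rw [Real.rpow_sub_one (by norm_num)]; ring
    intro U
    exact main _ U rfl

end Count

section Upper

/-- `x` and `y` alternate in `w`, starting with `x`, expressed by prefix counts. -/
def PrefAlt {V : Type*} [DecidableEq V] (w : List V) (x y : V) : Prop :=
  ∀ p, p <+: w → p.count y ≤ p.count x ∧ p.count x ≤ p.count y + 1

lemma prefAlt_cons {V : Type*} [DecidableEq V] (z : V) (w : List V) (x y : V) :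
    PrefAlt (z :: w) x y ↔ ∀ p, p <+: w → (z :: p).count y ≤ (z :: p).count x ∧
      (z :: p).count x ≤ (z :: p).count y + 1 := by
  constructor
  · intro h p hp
    exact h _ (by simpa using hp)
  · intro h p hp
    cases p with
    | nil => simp
    | cons a p =>
      rw [List.cons_prefix_cons] at hp
      obtain ⟨rfl, hp⟩ := hp
      exact h p hp

lemma alternates_iff {V : Type*} [DecidableEq V] (w : List V) (x y : V) :
    Alternates w x y ↔ (w.filter (fun z => z = x ∨ z = y)).IsChain (· ≠ ·) := Iff.rfl

lemma prefAlt_iff {V : Type*} [DecidableEq V] (w : List V) : ∀ (x y : V), x ≠ y →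
    (PrefAlt w x y ↔ Alternates w x y ∧ (w.filter (fun z => z = x ∨ z = y)).head? ≠ some y) := by
  induction w with
  | nil =>
    intro x y hxy
    simp [PrefAlt, alternates_iff]
  | cons z w ih =>
    intro x y hxy
    rw [prefAlt_cons]
    by_cases hzx : z = x
    · subst hzx
      have e : PrefAlt w y z ↔ _ := ih y z hxy.symm
      have e2 : (w.filter (fun u => u = y ∨ u = z)) = (w.filter (fun u => u = z ∨ u = y)) := by
        congr 1; funext u; simp [or_comm]
      rw [alternates_iff] at e ⊢
      rw [e2] at e
      have e3 : (∀ p, p <+: w → (z :: p).count y ≤ (z :: p).count z ∧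
          (z :: p).count z ≤ (z :: p).count y + 1) ↔ PrefAlt w y z := by
        unfold PrefAlt
        refine forall_congr' fun p => forall_congr' fun _ => ?_
        rw [List.count_cons_self, List.count_cons_of_ne hxy]
        omega
      rw [e3, e]
      rw [List.filter_cons_of_pos (by simp), List.isChain_cons]
      simp only [Option.mem_def, List.head?_cons, ne_eq, Option.some.injEq, hxy, not_false_eq_true,
        and_true]
      constructor
      · rintro ⟨h1, h2⟩
        refine ⟨?_, h1⟩
        rintro a ha rfl
        exact h2 ha
      · rintro ⟨h1, h2⟩
        exact ⟨h2, fun h => h1 z h rfl⟩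
    · by_cases hzy : z = y
      · subst hzy
        constructor
        · intro h
          have := (h [] (by simp)).1
          simp [hxy.symm] at this
        · rintro ⟨_, h⟩
          simp at h
      · have e := ih x y hxy
        rw [alternates_iff] at e ⊢
        rw [List.filter_cons_of_neg (by simp [hzx, hzy]), ← e]
        unfold PrefAlt
        refine forall_congr' fun p => forall_congr' fun _ => ?_
        rw [List.count_cons_of_ne hzy, List.count_cons_of_ne hzx]

lemma head_idx {V : Type*} [DecidableEq V] (w : List V) (x y : V) (hxy : x ≠ y)
    (h : (w.filter (fun z => z = x ∨ z = y)).head? = some y) : w.idxOf y < w.idxOf x := by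
  induction w with
  | nil => simp at h
  | cons z w ih =>
    by_cases hzx : z = x
    · subst hzx
      simp [hxy] at h
    · by_cases hzy : z = y
      · subst hzy
        rw [List.idxOf_cons_self, List.idxOf_cons_ne _ hzx]
        omega
      · rw [List.filter_cons_of_neg (by simp [hzx, hzy])] at h
        rw [List.idxOf_cons_ne _ hzx, List.idxOf_cons_ne _ hzy]
        have := ih h
        omega

/-- The order condition extracted from a word. -/
def OrdCond {n : ℕ} (G : SimpleGraph (Fin n)) : Prop :=
  ∀ a b c d, a < b → b < c → c < d → G.Adj a b → G.Adj b c → G.Adj c d → G.Adj a d → G.Adj a c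

lemma wr_order {V : Type*} [DecidableEq V] (G : SimpleGraph V) (h : WordRepresentable G) :
    ∃ f : V → ℕ, Function.Injective f ∧ ∀ a b c d, f a < f b → f b < f c → f c < f d →
      G.Adj a b → G.Adj b c → G.Adj c d → G.Adj a d → G.Adj a c := by
  obtain ⟨w, hw, hG⟩ := h
  refine ⟨fun v => w.idxOf v, ?_, ?_⟩
  · intro a b hab
    exact (List.idxOf_inj (hw a)).1 hab
  · intro a b c d hab hbc hcd eab ebc ecd ead
    have key : ∀ x y, w.idxOf x < w.idxOf y → G.Adj x y → PrefAlt w x y := by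
      intro x y hlt hadj
      rw [prefAlt_iff w x y hadj.ne]
      refine ⟨(hG x y hadj.ne).2 hadj, fun hh => ?_⟩
      have := head_idx w x y hadj.ne hh
      omega
    have hac : a ≠ c := by
      rintro rfl
      simp only at hab hbc
      omega
    rw [← hG a c hac]
    apply ((prefAlt_iff w a c hac).1 _).1
    intro p hp
    have h1 := key a b hab eab p hp
    have h2 := key b c hbc ebc p hp
    have h3 := key c d hcd ecd p hp
    have h4 := key a d (by simp only at hab hbc hcd; omega) ead p hp
    omega

lemma wr_iso_ord {n : ℕ} (G : SimpleGraph (Fin n)) (h : WordRepresentable G) :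
    ∃ H : SimpleGraph (Fin n), OrdCond H ∧ Nonempty (G ≃g H) := by
  obtain ⟨f, hf, hG⟩ := wr_order G h
  obtain ⟨σ, hσ⟩ : ∃ σ : Equiv.Perm (Fin n), σ = Tuple.sort f := ⟨_, rfl⟩
  have hm : StrictMono (f ∘ σ) := by
    rw [hσ]
    exact (Tuple.monotone_sort f).strictMono_of_injective
      (hf.comp (Equiv.injective _))
  refine ⟨G.comap σ, ?_, ⟨(SimpleGraph.Iso.comap σ G).symm⟩⟩
  intro a b c d hab hbc hcd e1 e2 e3 e4
  exact hG _ _ _ _ (hm hab) (hm hbc) (hm hcd) e1 e2 e3 e4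

open Classical in
lemma card_ord (n : ℕ) :
    (Finset.univ.filter (fun H : SimpleGraph (Fin n) => OrdCond H)).card ≤
      (Fam (Finset.univ : Finset (Fin n)) 4 1).card := by
  obtain ⟨E, hE⟩ : ∃ E : SimpleGraph (Fin n) → Finset (Fin n × Fin n),
    E = fun H => Finset.univ.filter (fun q => q.1 < q.2 ∧ H.Adj q.1 q.2) := ⟨_, rfl⟩
  have hmem : ∀ H x y, (x, y) ∈ E H ↔ x < y ∧ H.Adj x y := by intro H x y; simp [hE]
  have hinj : Function.Injective E := by
    intro G H h
    ext x y
    rcases lt_trichotomy x y with hl | hl | hl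
    · have := hmem G x y
      rw [h, hmem] at this
      tauto
    · subst hl; simp
    · have := hmem G y x
      rw [h, hmem] at this
      rw [G.adj_comm, H.adj_comm]
      tauto
  obtain ⟨F, hF⟩ : ∃ F, F = (Finset.univ.filter (fun H : SimpleGraph (Fin n) => OrdCond H)) :=
    ⟨_, rfl⟩
  rw [← hF, ← Finset.card_image_of_injective F hinj]
  refine (Finset.card_le_card_shatterer _).trans ?_
  have hup : ∀ S ∈ (F.image E).shatterer, ∀ x y, (x, y) ∈ S → x < y := by
    intro S hS x y hxy
    obtain ⟨u, hu, hSu⟩ := (Finset.mem_shatterer.1 hS).exists_superset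
    obtain ⟨H, -, rfl⟩ := Finset.mem_image.1 hu
    exact ((hmem H x y).1 (hSu hxy)).1
  apply Finset.card_le_card_of_injOn (fun S => SimpleGraph.fromRel (fun x y => (x, y) ∈ S))
  · intro S hS
    simp only [Finset.mem_coe] at hS ⊢
    simp only [Fam, Finset.mem_filter, Finset.mem_univ, true_and, and_self, implies_true]
    rintro ⟨A, -, hA2, hA3⟩
    choose a ha using fun i => Finset.card_eq_one.1 (hA2 i)
    have hadj : ∀ i j, i ≠ j → (a i, a j) ∈ S ∨ (a j, a i) ∈ S := by
      intro i j hij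
      have := hA3 i j hij (a i) (by simp [ha]) (a j) (by simp [ha])
      rw [SimpleGraph.fromRel_adj] at this
      exact this.2
    have hainj : Function.Injective a := by
      intro i j h
      by_contra hij
      have := hA3 i j hij (a i) (by simp [ha]) (a j) (by simp [ha])
      exact this.ne h
    have hcard : (Finset.univ.image a).card = 4 := by
      rw [Finset.card_image_of_injective _ hainj]; simp
    obtain ⟨e, he⟩ : ∃ e, e = (Finset.univ.image a).orderEmbOfFin hcard := ⟨_, rfl⟩
    have hem : ∀ i j, i < j → (e i, e j) ∈ S := by
      intro i j hij
      have hlt : e i < e j := e.strictMono hij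
      have hi : e i ∈ Finset.univ.image a := by rw [he]; exact Finset.orderEmbOfFin_mem _ _ _
      have hj : e j ∈ Finset.univ.image a := by rw [he]; exact Finset.orderEmbOfFin_mem _ _ _
      obtain ⟨i', -, hi'⟩ := Finset.mem_image.1 hi
      obtain ⟨j', -, hj'⟩ := Finset.mem_image.1 hj
      rw [← hi', ← hj'] at hlt ⊢
      rcases hadj i' j' (by rintro rfl; exact lt_irrefl _ hlt) with h | h
      · exact h
      · exact absurd (hup S hS _ _ h) (not_lt.2 hlt.le)
    obtain ⟨u, hu, hSu⟩ := (Finset.mem_shatterer.1 hS) (Finset.erase_subset (e 0, e 2) S)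
    obtain ⟨H, hH, rfl⟩ := Finset.mem_image.1 hu
    rw [hF, Finset.mem_filter] at hH
    have hyes : ∀ i j, i < j → (i, j) ≠ (0, 2) → H.Adj (e i) (e j) := by
      intro i j hij hne
      have h1 : (e i, e j) ∈ S.erase (e 0, e 2) := by
        rw [Finset.mem_erase]
        refine ⟨?_, hem i j hij⟩
        intro h
        simp only [Prod.mk.injEq, EmbeddingLike.apply_eq_iff_eq] at h
        exact hne (by rw [h.1, h.2])
      rw [← hSu, Finset.mem_inter] at h1
      exact ((hmem H _ _).1 h1.2).2
    have hno : (e 0, e 2) ∉ S.erase (e 0, e 2) := Finset.notMem_erase _ _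
    rw [← hSu, Finset.mem_inter] at hno
    apply hno
    refine ⟨hem 0 2 (by decide), (hmem _ _ _).2 ⟨e.strictMono (by decide), ?_⟩⟩
    exact hH.2 (e 0) (e 1) (e 2) (e 3) (e.strictMono (by decide)) (e.strictMono (by decide))
      (e.strictMono (by decide)) (hyes 0 1 (by decide) (by decide))
      (hyes 1 2 (by decide) (by decide)) (hyes 2 3 (by decide) (by decide))
      (hyes 0 3 (by decide) (by decide))
  · intro S hS S' hS' h
    simp only [Finset.mem_coe] at hS hS'
    have hiff : ∀ x y, x < y → ((x, y) ∈ S ↔ (x, y) ∈ S') := by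
      intro x y hxy
      have h1 : (SimpleGraph.fromRel (fun x y => (x, y) ∈ S)).Adj x y ↔
        (SimpleGraph.fromRel (fun x y => (x, y) ∈ S')).Adj x y := by simp only at h; rw [h]
      rw [SimpleGraph.fromRel_adj, SimpleGraph.fromRel_adj] at h1
      have h2 : (y, x) ∉ S := fun hh => absurd (hup S hS _ _ hh) (not_lt.2 hxy.le)
      have h3 : (y, x) ∉ S' := fun hh => absurd (hup S' hS' _ _ hh) (not_lt.2 hxy.le)
      have h4 := hxy.ne
      tauto
    ext ⟨x, y⟩
    constructor
    · intro hx
      exact (hiff x y (hup S hS _ _ hx)).1 hx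
    · intro hx
      exact (hiff x y (hup S' hS' _ _ hx)).2 hx

lemma numUnlabelled_le (n : ℕ) :
    numUnlabelled n ≤ (Fam (Finset.univ : Finset (Fin n)) 4 1).card := by
  classical
  refine le_trans ?_ (card_ord n)
  unfold numUnlabelled
  rw [← Fintype.card_coe, ← Nat.card_eq_fintype_card]
  choose H hH1 hH2 using fun G : {G : SimpleGraph (Fin n) // WordRepresentable G} =>
    wr_iso_ord G.1 G.2
  apply Nat.card_le_card_of_injective (fun q => (⟨H q.out, by simp [hH1]⟩ :
    ↥(Finset.univ.filter (fun H : SimpleGraph (Fin n) => OrdCond H))))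
  intro q q' h
  simp only [Subtype.mk.injEq] at h
  rw [← Quot.out_eq q, ← Quot.out_eq q']
  apply Quot.sound
  obtain ⟨i1⟩ := hH2 q.out
  obtain ⟨i2⟩ := hH2 q'.out
  rw [← h] at i2
  exact ⟨i1.trans i2.symm⟩

lemma upper_bound (ε : ℝ) (hε : 0 < ε) : ∃ C : ℝ, ∀ n : ℕ,
    (numUnlabelled n : ℝ) ≤ 2 ^ ((1 / 3 + ε) * (n:ℝ) ^ 2 + C) := by
  obtain ⟨C, hC⟩ := fam_bound 3 1 ε hε
  refine ⟨C, fun n => ?_⟩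
  have h1 := hC (Fin n) Finset.univ
  have h2 : (numUnlabelled n : ℝ) ≤ (Fam (Finset.univ : Finset (Fin n)) 4 1).card := by
    exact_mod_cast numUnlabelled_le n
  refine h2.trans (h1.trans_eq ?_)
  norm_num

end Upper

section Lower

lemma alternates_symm {V : Type*} [DecidableEq V] {w : List V} {x y : V}
    (h : Alternates w x y) : Alternates w y x := by
  rw [alternates_iff] at h ⊢
  have e2 : (w.filter (fun u => u = y ∨ u = x)) = (w.filter (fun u => u = x ∨ u = y)) := by
    congr 1; funext u; simp [or_comm]
  rwa [e2]

lemma alternates_infix {V : Type*} [DecidableEq V] {w w' : List V} {x y : V} (hw : w' <:+: w)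
    (h : Alternates w x y) : Alternates w' x y := by
  rw [alternates_iff] at h ⊢
  exact h.infix (hw.filter _)

/-- The restriction of `w` to `u, v` is `uvuv...uv`. -/
def EAlt {V : Type*} [DecidableEq V] (w : List V) (u v : V) : Prop :=
  ∃ k, w.filter (fun z => z = u ∨ z = v) = (List.replicate k [u, v]).flatten

lemma EAlt.append {V : Type*} [DecidableEq V] {w w' : List V} {u v : V} (h : EAlt w u v)
    (h' : EAlt w' u v) : EAlt (w ++ w') u v := by
  obtain ⟨k, hk⟩ := h
  obtain ⟨k', hk'⟩ := h'
  exact ⟨k + k', by rw [List.filter_append, hk, hk', List.replicate_add, List.flatten_append]⟩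

lemma EAlt.flatMap {V ι : Type*} [DecidableEq V] {f : ι → List V} {u v : V}
    (h : ∀ i, EAlt (f i) u v) (l : List ι) : EAlt (l.flatMap f) u v := by
  induction l with
  | nil => exact ⟨0, by simp⟩
  | cons a l ih =>
    rw [List.flatMap_cons]
    exact (h a).append ih

lemma EAlt.alternates {V : Type*} [DecidableEq V] {w : List V} {u v : V} (huv : u ≠ v)
    (h : EAlt w u v) : Alternates w u v := by
  obtain ⟨k, hk⟩ := h
  rw [alternates_iff, hk]
  clear hk
  have : ((List.replicate k [u, v]).flatten).IsChain (· ≠ ·) ∧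
      ∀ z ∈ ((List.replicate k [u, v]).flatten).head?, z = u := by
    induction k with
    | zero => simp
    | succ k ih =>
      rw [List.replicate_succ, List.flatten_cons]
      refine ⟨?_, by simp⟩
      simp only [List.cons_append, List.nil_append]
      rw [List.isChain_cons, List.isChain_cons]
      refine ⟨by simpa using huv, ?_, ih.1⟩
      intro z hz
      rw [ih.2 z hz]; exact huv.symm
  exact this.1

lemma flt {V : Type*} [DecidableEq V] (l : List V) (u v : V) (hl : l.Nodup) (huv : u ≠ v)
    (h : ¬ (u ∈ l ∧ v ∈ l)) : l.filter (fun z => z = u ∨ z = v) =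
      (if u ∈ l then [u] else []) ++ (if v ∈ l then [v] else []) := by
  induction l with
  | nil => simp
  | cons a l ih =>
    rw [List.nodup_cons] at hl
    have h' : ¬ (u ∈ l ∧ v ∈ l) := fun hh => h ⟨by simp [hh.1], by simp [hh.2]⟩
    have := ih hl.2 h'
    by_cases hau : a = u
    · subst hau
      have hv : v ∉ l := fun hv => h ⟨by simp, by simp [hv]⟩
      rw [List.filter_cons_of_pos (by simp), this]
      simp [hl.1, hv, huv.symm]
    · by_cases hav : a = v
      · subst hav
        have hu : u ∉ l := fun hv => h ⟨by simp [hv], by simp⟩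
        rw [List.filter_cons_of_pos (by simp), this]
        simp [hl.1, hu, huv]
      · rw [List.filter_cons_of_neg (by simp [hau, hav]), this]
        simp [Ne.symm hau, Ne.symm hav]

set_option linter.unusedSimpArgs false in
set_option maxHeartbeats 1000000 in
lemma exists_block {V : Type*} [Fintype V] [DecidableEq V] (col : V → Fin 3) (G : SimpleGraph V)
    (A B C : List V) (hAn : A.Nodup) (hBn : B.Nodup)
    (hCn : C.Nodup) (hA : ∀ z, z ∈ A ↔ col z = 0) (hB : ∀ z, z ∈ B ↔ col z = 1)
    (hC : ∀ z, z ∈ C ↔ col z = 2) (x y : V) : ∃ w : List V,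
      (∀ u v, G.Adj u v → col u < col v → EAlt w u v) ∧
      (x ≠ y → ¬ G.Adj x y → col x ≤ col y → ¬ Alternates w x y) := by
  have flt' : ∀ l : List V, l.Nodup → ∀ i : Fin 3, (∀ z, z ∈ l → col z = i) → ∀ u v,
      col u < col v → l.filter (fun z => z = u ∨ z = v) =
      (if u ∈ l then [u] else []) ++ (if v ∈ l then [v] else []) := by
    intro l hl i hi u v huv
    refine flt l u v hl (fun h => huv.ne (by rw [h])) ?_
    rintro ⟨h1, h2⟩
    rw [hi u h1, hi v h2] at huv
    exact lt_irrefl _ huv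
  have fA := flt' A hAn 0 (fun z => (hA z).1)
  have fB := flt' B hBn 1 (fun z => (hB z).1)
  have fC := flt' C hCn 2 (fun z => (hC z).1)
  have fA' := flt' (A.erase x) (hAn.erase x) 0 (fun z hz => (hA z).1 (List.mem_of_mem_erase hz))
  have fB' := flt' (B.erase x) (hBn.erase x) 1 (fun z hz => (hB z).1 (List.mem_of_mem_erase hz))
  have fB'' := flt' (B.erase y) (hBn.erase y) 1 (fun z hz => (hB z).1 (List.mem_of_mem_erase hz))
  have fC' := flt' (C.erase y) (hCn.erase y) 2 (fun z hz => (hC z).1 (List.mem_of_mem_erase hz))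
  have fx := flt' [x] (by simp) (col x) (by simp)
  have fy := flt' [y] (by simp) (col y) (by simp)
  have hcols : ∀ u v, col u < col v →
      (col u = 0 ∧ col v = 1) ∨ (col u = 0 ∧ col v = 2) ∨ (col u = 1 ∧ col v = 2) := by
    intro u v
    generalize col u = i
    generalize col v = j
    revert i j
    decide
  rcases lt_trichotomy (col x) (col y) with hlt | heq | hgt
  · by_cases hadj : G.Adj x y
    · refine ⟨A ++ B ++ C, ?_, fun _ h => absurd hadj h⟩
      intro u v huv huv'
      refine ⟨1, ?_⟩
      simp only [List.filter_append, fA u v huv', fB u v huv', fC u v huv', hA, hB, hC]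
      rcases hcols u v huv' with ⟨h1, h2⟩ | ⟨h1, h2⟩ | ⟨h1, h2⟩ <;> simp [h1, h2]
    · rcases hcols x y hlt with ⟨hx, hy⟩ | ⟨hx, hy⟩ | ⟨hx, hy⟩
      · refine ⟨A ++ B ++ C ++ (A.erase x ++ [y] ++ [x] ++ B.erase y ++ C), ?_, fun hxy _ _ => ?_⟩
        · intro u v huv huv'
          refine ⟨2, ?_⟩
          have hne : ¬ (u = x ∧ v = y) := by
            rintro ⟨rfl, rfl⟩; exact hadj huv
          simp only [List.filter_append, fA u v huv', fB u v huv', fC u v huv', fA' u v huv',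
            fB' u v huv', fB'' u v huv', fC' u v huv', fx u v huv', fy u v huv', hA, hB, hC,
            hAn.mem_erase_iff, hBn.mem_erase_iff, hCn.mem_erase_iff, List.mem_singleton]
          rcases hcols u v huv' with ⟨h1, h2⟩ | ⟨h1, h2⟩ | ⟨h1, h2⟩ <;>
            clear * - hne hx hy h1 h2 <;>
            by_cases hux : u = x <;> by_cases huy : u = y <;> by_cases hvx : v = x <;>
            by_cases hvy : v = y <;> simp_all
        · have e : (A ++ B ++ C ++ (A.erase x ++ [y] ++ [x] ++ B.erase y ++ C)).filter (fun z => z = x ∨ z = y)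
              = [x, y, y, x] := by
            simp only [List.filter_append, fA x y hlt, fB x y hlt, fC x y hlt, fA' x y hlt,
            fB' x y hlt, fB'' x y hlt, fC' x y hlt, fx x y hlt, fy x y hlt, hA, hB, hC,
            hAn.mem_erase_iff, hBn.mem_erase_iff, hCn.mem_erase_iff, List.mem_singleton]
            simp [hx, hy, hxy, hxy.symm]
          rw [alternates_iff, e]
          simp
      · refine ⟨A.erase x ++ [x] ++ B ++ C.erase y ++ [x] ++ [y] ++ A.erase x ++ B ++ C.erase y ++ [y], ?_, fun hxy _ _ => ?_⟩
        · intro u v huv huv'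
          refine ⟨2, ?_⟩
          have hne : ¬ (u = x ∧ v = y) := by
            rintro ⟨rfl, rfl⟩; exact hadj huv
          simp only [List.filter_append, fA u v huv', fB u v huv', fC u v huv', fA' u v huv',
            fB' u v huv', fB'' u v huv', fC' u v huv', fx u v huv', fy u v huv', hA, hB, hC,
            hAn.mem_erase_iff, hBn.mem_erase_iff, hCn.mem_erase_iff, List.mem_singleton]
          rcases hcols u v huv' with ⟨h1, h2⟩ | ⟨h1, h2⟩ | ⟨h1, h2⟩ <;>
            clear * - hne hx hy h1 h2 <;>
            by_cases hux : u = x <;> by_cases huy : u = y <;> by_cases hvx : v = x <;>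
            by_cases hvy : v = y <;> simp_all
        · have e : (A.erase x ++ [x] ++ B ++ C.erase y ++ [x] ++ [y] ++ A.erase x ++ B ++ C.erase y ++ [y]).filter (fun z => z = x ∨ z = y)
              = [x, x, y, y] := by
            simp only [List.filter_append, fA x y hlt, fB x y hlt, fC x y hlt, fA' x y hlt,
            fB' x y hlt, fB'' x y hlt, fC' x y hlt, fx x y hlt, fy x y hlt, hA, hB, hC,
            hAn.mem_erase_iff, hBn.mem_erase_iff, hCn.mem_erase_iff, List.mem_singleton]
            simp [hx, hy, hxy, hxy.symm]
          rw [alternates_iff, e]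
          simp
      · refine ⟨A ++ B ++ C ++ (A ++ B.erase x ++ [y] ++ [x] ++ C.erase y), ?_, fun hxy _ _ => ?_⟩
        · intro u v huv huv'
          refine ⟨2, ?_⟩
          have hne : ¬ (u = x ∧ v = y) := by
            rintro ⟨rfl, rfl⟩; exact hadj huv
          simp only [List.filter_append, fA u v huv', fB u v huv', fC u v huv', fA' u v huv',
            fB' u v huv', fB'' u v huv', fC' u v huv', fx u v huv', fy u v huv', hA, hB, hC,
            hAn.mem_erase_iff, hBn.mem_erase_iff, hCn.mem_erase_iff, List.mem_singleton]
          rcases hcols u v huv' with ⟨h1, h2⟩ | ⟨h1, h2⟩ | ⟨h1, h2⟩ <;>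
            clear * - hne hx hy h1 h2 <;>
            by_cases hux : u = x <;> by_cases huy : u = y <;> by_cases hvx : v = x <;>
            by_cases hvy : v = y <;> simp_all
        · have e : (A ++ B ++ C ++ (A ++ B.erase x ++ [y] ++ [x] ++ C.erase y)).filter (fun z => z = x ∨ z = y)
              = [x, y, y, x] := by
            simp only [List.filter_append, fA x y hlt, fB x y hlt, fC x y hlt, fA' x y hlt,
            fB' x y hlt, fB'' x y hlt, fC' x y hlt, fx x y hlt, fy x y hlt, hA, hB, hC,
            hAn.mem_erase_iff, hBn.mem_erase_iff, hCn.mem_erase_iff, List.mem_singleton]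
            simp [hx, hy, hxy, hxy.symm]
          rw [alternates_iff, e]
          simp
  · refine ⟨A ++ B ++ C ++ (A.reverse ++ B.reverse ++ C.reverse), ?_, fun hxy _ _ => ?_⟩
    · intro u v huv huv'
      refine ⟨2, ?_⟩
      simp only [List.filter_append, List.filter_reverse, fA u v huv', fB u v huv', fC u v huv',
        hA, hB, hC]
      rcases hcols u v huv' with ⟨h1, h2⟩ | ⟨h1, h2⟩ | ⟨h1, h2⟩ <;> simp [h1, h2]
    · have f0 : ∀ l : List V, x ∉ l → y ∉ l → l.filter (fun z => z = x ∨ z = y) = [] := by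
        intro l h1 h2
        rw [List.filter_eq_nil_iff]
        intro a ha
        simp only [decide_eq_true_eq, not_or]
        exact ⟨fun h => h1 (h ▸ ha), fun h => h2 (h ▸ ha)⟩
      have fin : ∀ l : List V, x ∈ l → ¬ (l.filter (fun z => z = x ∨ z = y) ++
          (l.filter (fun z => z = x ∨ z = y)).reverse).IsChain (· ≠ ·) := by
        intro l hx hch
        have hm : x ∈ l.filter (fun z => z = x ∨ z = y) := by simp [hx]
        revert hch hm
        generalize l.filter (fun z => z = x ∨ z = y) = m
        intro hch hm
        rw [List.isChain_append] at hch
        have hne : m ≠ [] := List.ne_nil_of_mem hm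
        refine hch.2.2 (m.getLast hne) (by simp [List.getLast?_eq_getLast_of_ne_nil hne])
          (m.getLast hne) ?_ rfl
        rw [List.head?_reverse]
        simp [List.getLast?_eq_getLast_of_ne_nil hne]
      rw [alternates_iff]
      simp only [List.filter_append, List.filter_reverse]
      have h3 : col x = 0 ∨ col x = 1 ∨ col x = 2 := by
        generalize col x = i
        revert i
        decide
      rcases h3 with h | h | h
      · rw [f0 B (by simp [hB, h]) (by simp [hB, ← heq, h]),
          f0 C (by simp [hC, h]) (by simp [hC, ← heq, h])]
        simpa using fin A ((hA x).2 h)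
      · rw [f0 A (by simp [hA, h]) (by simp [hA, ← heq, h]),
          f0 C (by simp [hC, h]) (by simp [hC, ← heq, h])]
        simpa using fin B ((hB x).2 h)
      · rw [f0 A (by simp [hA, h]) (by simp [hA, ← heq, h]),
          f0 B (by simp [hB, h]) (by simp [hB, ← heq, h])]
        simpa using fin C ((hC x).2 h)
  · exact ⟨[], fun u v _ _ => ⟨0, by simp⟩, fun _ _ h => absurd hgt (not_lt.2 h)⟩

lemma wr_of_tripartite {V : Type*} [Fintype V] [DecidableEq V] (col : V → Fin 3)
    (G : SimpleGraph V) (hG : ∀ u v, G.Adj u v → col u ≠ col v) : WordRepresentable G := by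
  obtain ⟨L, hL⟩ : ∃ L : Fin 3 → List V, L = fun i => (Finset.univ.filter (fun v => col v = i)).toList :=
    ⟨_, rfl⟩
  have hLn : ∀ i, (L i).Nodup := fun i => by rw [hL]; exact Finset.nodup_toList _
  have hLm : ∀ i z, z ∈ L i ↔ col z = i := fun i z => by simp [hL]
  choose w hw1 hw2 using fun p : V × V => exists_block col G (L 0) (L 1) (L 2) (hLn 0) (hLn 1)
    (hLn 2) (hLm 0) (hLm 1) (hLm 2) p.1 p.2
  have hw0 : ∀ u v, G.Adj u v → col u < col v → EAlt (L 0 ++ L 1 ++ L 2) u v := by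
    intro u v huv huv'
    have hf : ∀ i, (L i).filter (fun z => z = u ∨ z = v) =
        (if col u = i then [u] else []) ++ (if col v = i then [v] else []) := by
      intro i
      rw [flt (L i) u v (hLn i) huv.ne]
      · simp only [hLm]
      · rw [hLm, hLm]
        rintro ⟨h1, h2⟩
        exact huv'.ne (h1.trans h2.symm)
    refine ⟨1, ?_⟩
    simp only [List.filter_append, hf]
    clear hf
    revert huv'
    generalize col u = i
    generalize col v = j
    intro h
    fin_cases i <;> fin_cases j <;> simp at h ⊢
  refine ⟨(Finset.univ : Finset (V × V)).toList.flatMap w ++ (L 0 ++ L 1 ++ L 2), ?_, ?_⟩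
  · intro v
    apply List.mem_append_right
    have h3 : col v = 0 ∨ col v = 1 ∨ col v = 2 := by
      generalize col v = i
      revert i
      decide
    simp only [List.mem_append, hLm]
    tauto
  · have pos : ∀ x y, col x < col y → G.Adj x y → Alternates
        ((Finset.univ : Finset (V × V)).toList.flatMap w ++ (L 0 ++ L 1 ++ L 2)) x y := by
      intro x y hlt hadj
      apply EAlt.alternates hadj.ne
      exact (EAlt.flatMap (fun p => hw1 p x y hadj hlt) _).append (hw0 x y hadj hlt)
    have neg : ∀ x y, x ≠ y → col x ≤ col y → ¬ G.Adj x y → ¬ Alternates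
        ((Finset.univ : Finset (V × V)).toList.flatMap w ++ (L 0 ++ L 1 ++ L 2)) x y := by
      intro x y hxy hle hadj halt
      refine hw2 (x, y) hxy hadj hle (alternates_infix ?_ halt)
      obtain ⟨s, t, hst⟩ := List.append_of_mem
        (Finset.mem_toList.2 (Finset.mem_univ ((x, y) : V × V)))
      rw [hst]
      refine ⟨s.flatMap w, t.flatMap w ++ (L 0 ++ L 1 ++ L 2), ?_⟩
      simp
    intro x y hxy
    constructor
    · intro h
      by_contra hadj
      rcases le_total (col x) (col y) with hle | hle
      · exact neg x y hxy hle hadj h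
      · exact neg y x hxy.symm hle (fun h' => hadj h'.symm) (alternates_symm h)
    · intro h
      rcases lt_or_gt_of_ne (hG x y h) with hlt | hlt
      · exact pos x y hlt h
      · exact alternates_symm (pos y x hlt h.symm)

lemma labelled_le (n : ℕ) : Nat.card {G : SimpleGraph (Fin n) // WordRepresentable G} ≤
    numUnlabelled n * n.factorial := by
  classical
  have hp : n.factorial = Nat.card (Equiv.Perm (Fin n)) := by
    rw [Nat.card_eq_fintype_card, Fintype.card_perm, Fintype.card_fin]
  unfold numUnlabelled
  rw [hp, ← Nat.card_prod]
  obtain ⟨R, hR⟩ : ∃ R : {G : SimpleGraph (Fin n) // WordRepresentable G} →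
    {G : SimpleGraph (Fin n) // WordRepresentable G} → Prop,
    R = fun G H => Nonempty (G.1 ≃g H.1) := ⟨_, rfl⟩
  have hequiv : Equivalence R := by
    rw [hR]
    exact ⟨fun _ => ⟨SimpleGraph.Iso.refl⟩, fun ⟨i⟩ => ⟨i.symm⟩, fun ⟨i⟩ ⟨j⟩ => ⟨i.trans j⟩⟩
  rw [← hR]
  have hiso : ∀ G : {G : SimpleGraph (Fin n) // WordRepresentable G},
      Nonempty (G.1 ≃g ((Quot.mk R G).out).1) := by
    intro G
    have h1 : Quot.mk R G = Quot.mk R (Quot.mk R G).out := (Quot.out_eq _).symm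
    have h2 := (hequiv.eqvGen_iff).1 (Quot.eqvGen_exact h1)
    rw [hR] at h2 ⊢
    exact h2
  apply Nat.card_le_card_of_injective
    (fun G => ((Quot.mk R G, (hiso G).some.toEquiv) : Quot R × Equiv.Perm (Fin n)))
  intro G H h
  simp only [Prod.mk.injEq] at h
  obtain ⟨h1, h2⟩ := h
  apply Subtype.ext
  ext x y
  have e1 := (hiso G).some.map_adj_iff (v := x) (w := y)
  have e2 := (hiso H).some.map_adj_iff (v := x) (w := y)
  have e3 : ∀ z, (hiso G).some z = (hiso H).some z := fun z =>
    congrArg (fun σ : Equiv.Perm (Fin n) => σ z) h2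
  rw [← e1, ← e2, e3, e3, h1]

lemma labelled_ge (n : ℕ) : 2 ^ (3 * ((n/3) * (n/3))) ≤
    Nat.card {G : SimpleGraph (Fin n) // WordRepresentable G} := by
  classical
  obtain ⟨k, hk⟩ : ∃ k, k = n / 3 := ⟨_, rfl⟩
  have hkn : 3 * k ≤ n := by omega
  rw [← hk]
  have hc : 2 ^ (3 * (k * k)) = Nat.card (Finset (Fin 3 × Fin k × Fin k)) := by
    rw [Nat.card_eq_fintype_card, Fintype.card_finset]
    simp
  rw [hc]
  obtain ⟨col, hcol⟩ : ∃ col : Fin n → Fin 3,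
    col = fun v => if v.1 < k then 0 else if v.1 < 2 * k then 1 else 2 := ⟨_, rfl⟩
  obtain ⟨e1, he1⟩ : ∃ e1 : Fin 3 × Fin k × Fin k → Fin n,
    ∀ p, (e1 p).1 = if p.1 = 2 then k + p.2.1.1 else p.2.1.1 :=
    ⟨fun p => ⟨if p.1 = 2 then k + p.2.1.1 else p.2.1.1, by
      have := p.2.1.2; split_ifs <;> omega⟩, fun p => rfl⟩
  obtain ⟨e2, he2⟩ : ∃ e2 : Fin 3 × Fin k × Fin k → Fin n,
    ∀ p, (e2 p).1 = if p.1 = 0 then k + p.2.2.1 else 2 * k + p.2.2.1 :=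
    ⟨fun p => ⟨if p.1 = 0 then k + p.2.2.1 else 2 * k + p.2.2.1, by
      have := p.2.2.2; split_ifs <;> omega⟩, fun p => rfl⟩
  have hlt : ∀ p, col (e1 p) < col (e2 p) := by
    rintro ⟨c, i, j⟩
    have hi := i.2
    have hj := j.2
    rw [hcol]
    simp only [he1, he2]
    fin_cases c
    · have a1 : ¬ (k + j.1 < k) := by omega
      have a2 : k + j.1 < 2 * k := by omega
      simp [a2]
    · have a1 : ¬ (2 * k + j.1 < k) := by omega
      simp [a1]
    · have a1 : ¬ (2 * k + j.1 < k) := by omega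
      have a2 : k + i.1 < 2 * k := by omega
      simp [a1, a2]
  have hinj : ∀ p q, e1 p = e1 q → e2 p = e2 q → p = q := by
    rintro ⟨c, i, j⟩ ⟨c', i', j'⟩ h1 h2
    have h1' := congrArg Fin.val h1
    have h2' := congrArg Fin.val h2
    rw [he1, he1] at h1'
    rw [he2, he2] at h2'
    have hi := i.2
    have hj := j.2
    have hi' := i'.2
    have hj' := j'.2
    simp only [Prod.mk.injEq, Fin.ext_iff]
    fin_cases c <;> fin_cases c' <;> simp at h1' h2' ⊢ <;> omega
  obtain ⟨Gr, hGr⟩ : ∃ Gr : Finset (Fin 3 × Fin k × Fin k) → SimpleGraph (Fin n),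
    ∀ S x y, (Gr S).Adj x y ↔ x ≠ y ∧ ((∃ p ∈ S, e1 p = x ∧ e2 p = y) ∨
      (∃ p ∈ S, e1 p = y ∧ e2 p = x)) :=
    ⟨fun S => SimpleGraph.fromRel (fun x y => ∃ p ∈ S, e1 p = x ∧ e2 p = y),
      fun S x y => SimpleGraph.fromRel_adj _ _ _⟩
  have hmem : ∀ S p, p ∈ S ↔ (Gr S).Adj (e1 p) (e2 p) := by
    intro S p
    rw [hGr]
    constructor
    · intro hp
      exact ⟨fun h => (hlt p).ne (by rw [h]), Or.inl ⟨p, hp, rfl, rfl⟩⟩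
    · rintro ⟨_, ⟨q, hq, h1, h2⟩ | ⟨q, hq, h1, h2⟩⟩
      · rwa [← hinj q p h1 h2]
      · have a := hlt q
        rw [h1, h2] at a
        exact absurd a (not_lt.2 (hlt p).le)
  apply Nat.card_le_card_of_injective (fun S => (⟨Gr S, wr_of_tripartite col (Gr S) (by
    intro u v h
    rw [hGr] at h
    rcases h with ⟨_, ⟨q, hq, rfl, rfl⟩ | ⟨q, hq, rfl, rfl⟩⟩
    · exact (hlt q).ne
    · exact (hlt q).ne')⟩ : {G : SimpleGraph (Fin n) // WordRepresentable G}))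
  intro S S' h
  simp only [Subtype.mk.injEq] at h
  ext p
  rw [hmem, hmem, h]

lemma lower_bound (n : ℕ) (hn : 2 ≤ n) :
    ((n:ℝ) - 2) ^ 2 / 3 - n * Real.logb 2 n ≤ Real.logb 2 (numUnlabelled n) := by
  have h1 := (labelled_ge n).trans ((labelled_le n).trans
    (Nat.mul_le_mul_left _ (Nat.factorial_le_pow n)))
  have hpos : 0 < numUnlabelled n := by
    rcases Nat.eq_zero_or_pos (numUnlabelled n) with h | h
    · rw [h, zero_mul] at h1
      have : 0 < 2 ^ (3 * ((n/3) * (n/3))) := by positivity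
      omega
    · exact h
  have hposR : (0:ℝ) < numUnlabelled n := by exact_mod_cast hpos
  have hnR : (0:ℝ) < n := by exact_mod_cast (by omega : 0 < n)
  have h2 : (2:ℝ) ^ (3 * ((n/3) * (n/3))) ≤ numUnlabelled n * (n:ℝ) ^ n := by exact_mod_cast h1
  have h3 := Real.logb_le_logb_of_le (b := 2) (by norm_num) (by positivity) h2
  rw [Real.logb_mul hposR.ne' (by positivity), Real.logb_pow, Real.logb_pow,
    Real.logb_self_eq_one (by norm_num)] at h3
  have h4 : ((n:ℝ) - 2) / 3 ≤ ((n/3 : ℕ) : ℝ) := by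
    have : n ≤ 3 * (n/3) + 2 := by omega
    have : (n:ℝ) ≤ 3 * ((n/3:ℕ):ℝ) + 2 := by exact_mod_cast this
    linarith
  have h5 : (0:ℝ) ≤ ((n:ℝ) - 2) / 3 := by
    have : (2:ℝ) ≤ n := by exact_mod_cast hn
    linarith
  push_cast at h3
  nlinarith

end Lower

theorem unlabelled_speed_wordRepresentable :
    Filter.Tendsto (fun n : ℕ => Real.logb 2 (numUnlabelled n) / (n.choose 2 : ℝ))
      Filter.atTop (nhds (2 / 3)) := by
  have hinv : Filter.Tendsto (fun n : ℕ => (1:ℝ) / n) Filter.atTop (nhds 0) :=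
    tendsto_one_div_atTop_nhds_zero_nat
  have hlog : Filter.Tendsto (fun n : ℕ => Real.logb 2 n / n) Filter.atTop (nhds 0) := by
    have h := (Real.isLittleO_log_id_atTop.tendsto_div_nhds_zero).comp
      (tendsto_natCast_atTop_atTop (R := ℝ))
    have h2 := h.div_const (Real.log 2)
    rw [zero_div] at h2
    refine h2.congr fun n => ?_
    simp only [Function.comp, id, Real.logb]
    ring
  have hch : ∀ n : ℕ, 2 ≤ n → (0:ℝ) < (n.choose 2 : ℝ) := by
    intro n hn
    exact_mod_cast Nat.choose_pos hn
  rw [tendsto_order]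
  constructor
  · intro a ha
    have hL : Filter.Tendsto (fun n : ℕ => ((1 - 2 * ((1:ℝ) / n)) ^ 2 / 3 - Real.logb 2 n / n) /
        ((1 - 1 / n) / 2)) Filter.atTop (nhds (((1 - 2 * 0) ^ 2 / 3 - 0) / ((1 - 0) / 2))) := by
      refine Filter.Tendsto.div ?_ ((tendsto_const_nhds.sub hinv).div_const 2) (by norm_num)
      exact (((tendsto_const_nhds.sub (hinv.const_mul 2)).pow 2).div_const 3).sub hlog
    have hL' := (tendsto_order.1 hL).1 a (by norm_num; linarith)
    filter_upwards [hL', Filter.eventually_ge_atTop 2] with n hn hn2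
    refine lt_of_lt_of_le hn ?_
    have hn2R : (2:ℝ) ≤ n := by exact_mod_cast hn2
    have hb := lower_bound n hn2
    have e : ((1 - 2 * ((1:ℝ) / n)) ^ 2 / 3 - Real.logb 2 n / n) / ((1 - 1 / n) / 2) =
        (((n:ℝ) - 2) ^ 2 / 3 - n * Real.logb 2 n) / (n.choose 2 : ℝ) := by
      rw [Nat.cast_choose_two]
      have h1 : (n:ℝ) - 1 ≠ 0 := by linarith
      have h2 : (n:ℝ) ≠ 0 := by linarith
      field_simp
    rw [e]
    have := hch n hn2
    gcongr
  · intro b hb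
    obtain ⟨ε, hε⟩ : ∃ ε : ℝ, ε = (b - 2/3) / 4 := ⟨_, rfl⟩
    have hε0 : 0 < ε := by rw [hε]; linarith
    obtain ⟨C, hC⟩ := upper_bound ε hε0
    have hU : Filter.Tendsto (fun n : ℕ => ((1 / 3 + ε) + C * ((1:ℝ) / n * (1 / n))) /
        ((1 - 1 / n) / 2)) Filter.atTop (nhds (((1 / 3 + ε) + C * (0 * 0)) / ((1 - 0) / 2))) := by
      refine Filter.Tendsto.div ?_ ((tendsto_const_nhds.sub hinv).div_const 2) (by norm_num)
      exact tendsto_const_nhds.add ((hinv.mul hinv).const_mul C)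
    have hU' := (tendsto_order.1 hU).2 b (by
      have : ((1 / 3 + ε) + C * (0 * 0)) / ((1 - 0) / 2) = 2 / 3 + 2 * ε := by ring
      rw [this, hε]; linarith)
    filter_upwards [hU', Filter.eventually_ge_atTop 2] with n hn hn2
    refine lt_of_le_of_lt ?_ hn
    have hn2R : (2:ℝ) ≤ n := by exact_mod_cast hn2
    have e : ((1 / 3 + ε) + C * ((1:ℝ) / n * (1 / n))) / ((1 - 1 / n) / 2) =
        ((1 / 3 + ε) * (n:ℝ) ^ 2 + C) / (n.choose 2 : ℝ) := by
      rw [Nat.cast_choose_two]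
      have h1 : (n:ℝ) - 1 ≠ 0 := by linarith
      have h2 : (n:ℝ) ≠ 0 := by linarith
      field_simp
    rw [e]
    have := hch n hn2
    gcongr
    have hpos : 0 < numUnlabelled n := by
      have h1 := (labelled_ge n).trans (labelled_le n)
      rcases Nat.eq_zero_or_pos (numUnlabelled n) with h | h
      · rw [h, zero_mul] at h1
        have : 0 < 2 ^ (3 * ((n/3) * (n/3))) := by positivity
        omega
      · exact h
    have hposR : (0:ℝ) < numUnlabelled n := by exact_mod_cast hpos
    rw [Real.logb_le_iff_le_rpow (by norm_num) hposR]
    exact hC n
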